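/- There exists a transcendental meromorphic function f on ℂ such that all zeros of f lie on the ray {r e^{iπ/3} : r > 0}, all poles of f lie on the ray {r e^{−iπ/3} : r > 0}, and all 1-points of f lie on the negative real axis (−∞, 0). -/

import Mathlib

open Complex Filter Set Topology

noncomputable section

/-- The open ray emanating from the origin with direction angle `θ`. -/
def Ray (θ : ℝ) : Set ℂ :=
  {z : ℂ | ∃ t : ℝ, 0 < t ∧ z = (t : ℂ) * Complex.exp ((θ : ℂ) * Complex.I)}

/-- `f` is meromorphic on the open set `U` with pole set `P`. -/
def MeromOn (f : ℂ → ℂ) (P : Set ℂ) (U : Set ℂ) : Prop :=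
  P ⊆ U ∧ AnalyticOnNhd ℂ f (U \ P) ∧
    (∀ p ∈ P, Tendsto (fun z => ‖f z‖) (𝓝[≠] p) atTop) ∧
    ∀ z ∈ U, ¬ AccPt z (𝓟 P)

/-- `f` (meromorphic on `ℂ` with pole set `P`) is a rational function. -/
def IsRationalFn (f : ℂ → ℂ) (P : Set ℂ) : Prop :=
  ∃ p q : Polynomial ℂ, q ≠ 0 ∧ ∀ z ∉ P, q.eval z ≠ 0 → f z = p.eval z / q.eval z

open MeasureTheory

def airyE (k : ℕ) (z : ℂ) (x : ℝ) : ℂ :=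
  (I * (x + I)) ^ k * exp (I * (x + I) ^ 3 / 3 + I * (x + I) * z)

def airyF (k : ℕ) (z : ℂ) : ℂ := ∫ x : ℝ, airyE k z x

def airyC (k : ℕ) (M : ℝ) : ℝ := k.factorial * Real.exp (4 / 3 + (M + 1) ^ 2 / 2)

lemma airyE_bound (k : ℕ) (M : ℝ) (z : ℂ) (hz : |z.im| ≤ M) (x : ℝ) :
    ‖airyE k z x‖ ≤ Real.exp (-z.re) * (airyC k M * Real.exp (-(1 / 2) * x ^ 2)) := by
  have h1 : ‖I * ((x : ℂ) + I)‖ ≤ 1 + |x| := by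
    rw [norm_mul, norm_I, one_mul]
    refine (norm_add_le _ _).trans ?_
    rw [norm_I, norm_real, Real.norm_eq_abs]; linarith
  have h2 : ‖I * ((x : ℂ) + I)‖ ^ k ≤ k.factorial * Real.exp (1 + |x|) := by
    have h3 : (1 + |x|) ^ k / k.factorial ≤ Real.exp (1 + |x|) :=
      Real.pow_div_factorial_le_exp _ (by positivity) _
    rw [div_le_iff₀ (by positivity)] at h3
    calc _ ≤ (1 + |x|) ^ k := by gcongr
      _ ≤ _ := by linarith
  have h4 : (I * ((x : ℂ) + I) ^ 3 / 3 + I * (x + I) * z).re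
      = 1 / 3 - x ^ 2 - x * z.im - z.re := by
    have : (I * ((x : ℂ) + I) ^ 3 / 3 + I * (x + I) * z)
      = ((1 / 3 - x ^ 2 : ℝ) : ℂ) + ((x ^ 3 / 3 - x : ℝ) : ℂ) * I + (I * x - 1) * z := by
      push_cast
      linear_combination (x ^ 2 * I ^ 0 + x * I + I ^ 2 / 3 - 1/3 + z) * I_sq
    rw [this]
    simp only [add_re, ofReal_re, ofReal_im, mul_re, mul_im, sub_re, sub_im, I_re, I_im, one_re, one_im]
    ring
  rw [airyE, norm_mul, norm_pow, norm_exp, h4, airyC]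
  have h5 : -(x * z.im) ≤ M * |x| := by
    calc -(x * z.im) ≤ |x * z.im| := neg_le_abs _
      _ = |z.im| * |x| := by rw [abs_mul, mul_comm]
      _ ≤ _ := by gcongr
  calc _ ≤ (k.factorial * Real.exp (1 + |x|)) * Real.exp (1 / 3 - x ^ 2 - x * z.im - z.re) := by
        gcongr
    _ = k.factorial * Real.exp (1 + |x| + (1 / 3 - x ^ 2 - x * z.im - z.re)) := by
        rw [mul_assoc, ← Real.exp_add]
    _ ≤ k.factorial * Real.exp (-z.re + (4 / 3 + (M + 1) ^ 2 / 2) + -(1 / 2) * x ^ 2) := by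
        refine mul_le_mul_of_nonneg_left (Real.exp_le_exp.2 ?_) (by positivity)
        nlinarith [sq_nonneg (|x| - (M + 1)), sq_abs x]
    _ = _ := by rw [Real.exp_add, Real.exp_add]; ring

lemma gauss_int : Integrable (fun x : ℝ => Real.exp (-(1 / 2) * x ^ 2)) :=
  integrable_exp_neg_mul_sq (by norm_num)

lemma airyE_cont (k : ℕ) (z : ℂ) : Continuous (airyE k z) := by
  unfold airyE; fun_prop

lemma airyE_int (k : ℕ) (z : ℂ) : Integrable (airyE k z) := by
  refine Integrable.mono' ((gauss_int.const_mul (airyC k |z.im|)).const_mul (Real.exp (-z.re)))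
    (airyE_cont k z).aestronglyMeasurable ?_
  exact Eventually.of_forall fun x => airyE_bound k _ z le_rfl x

lemma airyE_deriv_z (k : ℕ) (z : ℂ) (x : ℝ) :
    HasDerivAt (fun z => airyE k z x) (airyE (k + 1) z x) z := by
  unfold airyE
  have h : HasDerivAt (fun z : ℂ => I * ((x : ℂ) + I) ^ 3 / 3 + I * (x + I) * z)
      (I * (x + I)) z := by
    simpa using ((hasDerivAt_id z).const_mul (I * ((x : ℂ) + I))).const_add (I * ((x : ℂ) + I) ^ 3 / 3)
  refine (h.cexp.const_mul ((I * ((x : ℂ) + I)) ^ k)).congr_deriv ?_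
  ring

lemma airyF_deriv (k : ℕ) (z : ℂ) : HasDerivAt (airyF k) (airyF (k + 1) z) z := by
  have := (hasDerivAt_integral_of_dominated_loc_of_deriv_le (μ := volume)
    (F := fun z x => airyE k z x) (F' := fun z x => airyE (k + 1) z x) (x₀ := z)
    (s := Metric.ball z 1)
    (bound := fun x => Real.exp (‖z‖ + 1) * (airyC (k + 1) (‖z‖ + 1) * Real.exp (-(1 / 2) * x ^ 2)))
    (Metric.ball_mem_nhds z one_pos)
    (Eventually.of_forall fun w => (airyE_cont k w).aestronglyMeasurable)
    (airyE_int k z) (airyE_cont (k + 1) z).aestronglyMeasurable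
    (Eventually.of_forall fun x w hw => ?_)
    ((gauss_int.const_mul _).const_mul _)
    (Eventually.of_forall fun x w hw => airyE_deriv_z k w x)).2
  · exact this
  · have h1 : ‖w‖ ≤ ‖z‖ + 1 := by
      have : ‖w - z‖ < 1 := by simpa [dist_eq_norm] using hw
      have := norm_sub_norm_le w z
      linarith
    refine (airyE_bound (k + 1) (‖z‖ + 1) w ((abs_im_le_norm w).trans h1) x).trans ?_
    have h2 : -w.re ≤ ‖z‖ + 1 := ((neg_le_abs _).trans (abs_re_le_norm w)).trans h1
    have h3 : 0 ≤ airyC (k + 1) (‖z‖ + 1) := by unfold airyC; positivity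
    gcongr

lemma airyF_decay (k : ℕ) (M : ℝ) : ∃ C : ℝ, 0 ≤ C ∧ ∀ z : ℂ, |z.im| ≤ M →
    ‖airyF k z‖ ≤ C * Real.exp (-z.re) := by
  refine ⟨∫ x : ℝ, airyC k M * Real.exp (-(1 / 2) * x ^ 2), ?_, fun z hz => ?_⟩
  · apply integral_nonneg
    intro x
    have h3 : 0 ≤ airyC k M := by unfold airyC; positivity
    positivity
  · rw [mul_comm, ← integral_const_mul]
    exact norm_integral_le_of_norm_le ((gauss_int.const_mul _).const_mul _)
      (Eventually.of_forall fun x => airyE_bound k M z hz x)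

lemma airyF_ode (z : ℂ) : airyF 2 z = z * airyF 0 z := by
  have h : ∀ x : ℝ, HasDerivAt (airyE 0 z) (-I * (airyE 2 z x - z * airyE 0 z x)) x := by
    intro x
    have h1 : HasDerivAt (fun x : ℝ => (x : ℂ) + I) 1 x := by
      simpa using (hasDerivAt_id x).ofReal_comp.add_const I
    have h2 := ((((h1.pow 3).const_mul I).div_const 3).add ((h1.const_mul I).mul_const z)).cexp
    unfold airyE
    simp only [pow_zero, one_mul]
    refine h2.congr_deriv ?_
    simp only [Pi.pow_apply, Pi.add_apply]
    push_cast
    linear_combination (exp (I * ((x : ℂ) + I) ^ 3 / 3 + I * (x + I) * z)) * I * (x + I) ^ 2 * I_sq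
  have h0 := integral_eq_zero_of_hasDerivAt_of_integrable h
    (((airyE_int 2 z).sub ((airyE_int 0 z).const_mul z)).const_mul (-I)) (airyE_int 0 z)
  rw [integral_const_mul, integral_sub (airyE_int 2 z) ((airyE_int 0 z).const_mul z),
    integral_const_mul] at h0
  have := (mul_eq_zero.1 h0).resolve_left (by simp)
  exact sub_eq_zero.1 this

lemma airyF_ne_zero : airyF 0 ≠ 0 := by
  intro h
  have hF : FourierTransform.fourier (airyE 0 0) = 0 := by
    ext w
    rw [Real.fourier_real_eq_integral_exp_smul]
    have h1 : airyF 0 ((-2 * Real.pi * w : ℝ) : ℂ) = 0 := by rw [h]; rfl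
    have h2 : ∀ v : ℝ, exp (↑(-2 * Real.pi * v * w) * I) • airyE 0 0 v
        = exp ((-2 * Real.pi * w : ℝ) : ℂ) * airyE 0 ((-2 * Real.pi * w : ℝ) : ℂ) v := by
      intro v
      simp only [airyE, pow_zero, one_mul, smul_eq_mul, ← exp_add]
      congr 1
      push_cast
      linear_combination (2 * Real.pi * w) * I_sq
    simp_rw [h2]
    rw [integral_const_mul]
    change _ * airyF 0 _ = _
    rw [h1]; simp
  have h3 := Continuous.fourierInv_fourier_eq (airyE_cont 0 0) (airyE_int 0 0) (by rw [hF]; exact integrable_zero _ _ _)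
  have h4 := congrFun h3 0
  rw [hF] at h4
  rw [Real.fourierInv_eq] at h4
  simp [airyE] at h4
  exact exp_ne_zero _ h4.symm

lemma airyF_diff (k : ℕ) : Differentiable ℂ (airyF k) := fun z => (airyF_deriv k z).differentiableAt

lemma airyF_an (k : ℕ) : AnalyticOnNhd ℂ (airyF k) univ := fun z _ => (airyF_diff k).analyticAt z

lemma airy_ray (a : ℂ) (h : ∀ t : ℝ, 0 < t → airyF 0 (a + t) = 0) : False := by
  apply airyF_ne_zero
  refine (airyF_an 0).eq_of_frequently_eq (g := 0) (fun _ _ => analyticAt_const) (z₀ := a) ?_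
  have h1 : Tendsto (fun t : ℝ => a + (t : ℂ)) (𝓝[>] 0) (𝓝[≠] a) := by
    refine tendsto_nhdsWithin_iff.2 ⟨?_, ?_⟩
    · have : ContinuousAt (fun t : ℝ => a + (t : ℂ)) 0 := by fun_prop
      have h2 := this.tendsto
      simp only [ofReal_zero, add_zero] at h2
      exact h2.mono_left nhdsWithin_le_nhds
    · filter_upwards [self_mem_nhdsWithin] with t ht
      have : t ≠ 0 := ne_of_gt ht
      simpa using this
  refine h1.frequently (Eventually.frequently ?_)
  filter_upwards [self_mem_nhdsWithin] with t ht
  exact h t ht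

lemma mono_zero (p p' : ℝ → ℝ) (hp : ∀ t, HasDerivAt p (p' t) t) (hn : ∀ t, 0 < t → 0 ≤ p' t)
    (h0 : p 0 = 0) (hl : Tendsto p atTop (𝓝 0)) : ∀ t, 0 < t → p' t = 0 := by
  have hm : MonotoneOn p (Ici 0) := by
    apply monotoneOn_of_deriv_nonneg (convex_Ici 0)
    · exact fun x _ => (hp x).continuousAt.continuousWithinAt
    · exact fun x _ => (hp x).differentiableAt.differentiableWithinAt
    · intro x hx
      rw [(hp x).deriv]
      rw [interior_Ici] at hx
      exact hn x hx
  have hz : ∀ t, 0 ≤ t → p t = 0 := by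
    intro t ht
    apply le_antisymm
    · refine ge_of_tendsto hl ?_
      filter_upwards [eventually_ge_atTop t] with s hs
      exact hm ht (ht.trans hs) hs
    · rw [← h0]; exact hm self_mem_Ici ht ht
  intro t ht
  have h1 : p =ᶠ[𝓝 t] fun _ => 0 := by
    filter_upwards [lt_mem_nhds ht] with s hs using hz s hs.le
  exact (hp t).unique ((hasDerivAt_const t (0:ℝ)).congr_of_eventuallyEq h1)

def airyH (a : ℂ) (t : ℝ) : ℂ := (starRingEnd ℂ) (airyF 0 (a + t)) * airyF 1 (a + t)

lemma airyH_deriv (a : ℂ) (t : ℝ) : HasDerivAt (airyH a)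
    ((‖airyF 1 (a + t)‖ ^ 2 : ℝ) + (a + t) * (‖airyF 0 (a + t)‖ ^ 2 : ℝ)) t := by
  have h0 : ∀ k, HasDerivAt (fun t : ℝ => airyF k (a + t)) (airyF (k + 1) (a + t)) t := by
    intro k
    have h1 : HasDerivAt (fun t : ℝ => a + (t : ℂ)) 1 t := by
      simpa using (hasDerivAt_id t).ofReal_comp.const_add a
    have h3 := (airyF_deriv k (a + t)).comp t h1
    rw [mul_one] at h3
    exact h3
  have h2 := ((h0 0).star).mul (h0 1)
  refine h2.congr_deriv ?_
  simp only [zero_add, Nat.reduceAdd, airyF_ode, star_def]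
  push_cast
  rw [← conj_mul', ← conj_mul']
  ring

lemma airyH_lim (a : ℂ) : Tendsto (airyH a) atTop (𝓝 0) := by
  obtain ⟨C, hC, h0⟩ := airyF_decay 0 |a.im|
  obtain ⟨D, hD, h1⟩ := airyF_decay 1 |a.im|
  have hl : Tendsto (fun t : ℝ => (C * Real.exp (-(a.re + t))) * (D * Real.exp (-(a.re + t)))) atTop (𝓝 0) := by
    have h2 : Tendsto (fun t : ℝ => Real.exp (-(a.re + t))) atTop (𝓝 0) :=
      Real.tendsto_exp_neg_atTop_nhds_zero.comp (tendsto_atTop_add_const_left _ _ tendsto_id)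
    simpa using (h2.const_mul C).mul (h2.const_mul D)
  refine squeeze_zero_norm (fun t => ?_) hl
  rw [airyH, norm_mul, RCLike.norm_conj]
  have e0 := h0 (a + t) (by simp)
  have e1 := h1 (a + t) (by simp)
  simp only [add_re, ofReal_re] at e0 e1
  gcongr

lemma airyH_re (a : ℂ) (ha : 0 ≤ a.re) (h : (airyH a 0).re = 0) : False := by
  have hd : ∀ t : ℝ, HasDerivAt (fun t => (airyH a t).re)
      (‖airyF 1 (a + t)‖ ^ 2 + (a.re + t) * ‖airyF 0 (a + t)‖ ^ 2) t := by
    intro t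
    have := (reCLM.hasFDerivAt (x := airyH a t)).comp_hasDerivAt t (airyH_deriv a t)
    refine this.congr_deriv ?_
    rw [reCLM_apply, add_re, ofReal_re, re_mul_ofReal, add_re, ofReal_re]
  have hl := (continuous_re.tendsto 0).comp (airyH_lim a)
  have := mono_zero _ _ hd (fun t ht => by positivity) h hl
  apply airy_ray a
  intro t ht
  have h1 := this t ht
  have h2 : 0 ≤ ‖airyF 1 (a + t)‖ ^ 2 := by positivity
  have h3 : 0 < a.re + t := by linarith
  have h4 : ‖airyF 0 (a + t)‖ ^ 2 ≤ 0 := by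
    by_contra! h5
    have := mul_pos h3 h5
    linarith
  simpa using h4

lemma airyH_im (a : ℂ) (ha : a.im ≠ 0) (h : (airyH a 0).im = 0) : False := by
  have hd : ∀ t : ℝ, HasDerivAt (fun t => a.im * (airyH a t).im)
      (a.im * (a.im * ‖airyF 0 (a + t)‖ ^ 2)) t := by
    intro t
    have := (imCLM.hasFDerivAt (x := airyH a t)).comp_hasDerivAt t (airyH_deriv a t)
    refine (this.const_mul a.im).congr_deriv ?_
    rw [imCLM_apply, add_im, ofReal_im, im_mul_ofReal, add_im, ofReal_im]; ring
  have hl := ((continuous_im.tendsto 0).comp (airyH_lim a)).const_mul a.im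
  have := mono_zero _ _ hd (fun t ht => by rw [← mul_assoc, ← sq]; positivity) (by simp [h])
    (by simpa using hl)
  apply airy_ray a
  intro t ht
  simpa [ha] using this t ht

lemma airy_zero (a : ℂ) (h : airyF 0 a = 0) : a.im = 0 ∧ a.re < 0 := by
  have h0 : airyH a 0 = 0 := by simp [airyH, h]
  constructor
  · by_contra h1; exact airyH_im a h1 (by simp [h0])
  · by_contra! h1; exact airyH_re a h1 (by simp [h0])

lemma airy0 : airyF 0 0 ≠ 0 := fun h => by simpa using (airy_zero 0 h).2

lemma airy1 : airyF 1 0 ≠ 0 := fun h => airyH_re 0 (by simp) (by simp [airyH, h])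

lemma airyRot_deriv (k : ℕ) (w z : ℂ) :
    HasDerivAt (fun z => airyF k (w * z)) (w * airyF (k + 1) (w * z)) z := by
  have h1 : HasDerivAt (fun z => w * z) w z := by simpa using (hasDerivAt_id z).const_mul w
  refine ((airyF_deriv k (w * z)).comp z h1).congr_deriv ?_
  ring

/-- Wronskian of two rotated solutions. -/
lemma airy_wronsk (w v : ℂ) (hw : w ^ 3 = 1) (hv : v ^ 3 = 1) (z : ℂ) :
    airyF 0 (w * z) * (v * airyF 1 (v * z)) - (w * airyF 1 (w * z)) * airyF 0 (v * z)
      = airyF 0 0 * airyF 1 0 * (v - w) := by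
  have hd : ∀ z, HasDerivAt (fun z => airyF 0 (w * z) * (v * airyF 1 (v * z))
      - (w * airyF 1 (w * z)) * airyF 0 (v * z)) 0 z := by
    intro z
    refine (((airyRot_deriv 0 w z).mul ((airyRot_deriv 1 v z).const_mul v)).sub
      (((airyRot_deriv 1 w z).const_mul w).mul (airyRot_deriv 0 v z))).congr_deriv ?_
    simp only [zero_add, Nat.reduceAdd, airyF_ode]
    linear_combination (z * airyF 0 (w * z) * airyF 0 (v * z)) * (hv - hw)
  have := is_const_of_deriv_eq_zero (fun z => (hd z).differentiableAt) (fun z => (hd z).deriv) z 0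
  rw [this]; simp; ring

lemma airy_sum (w : ℂ) (hw : w ^ 2 + w + 1 = 0) (z : ℂ) :
    airyF 0 z + w * airyF 0 (w * z) + w ^ 2 * airyF 0 (w ^ 2 * z) = 0 := by
  have hw3 : w ^ 3 = 1 := by linear_combination (w - 1) * hw
  set S : ℂ → ℂ := fun z => airyF 0 z + w * airyF 0 (w * z) + w ^ 2 * airyF 0 (w ^ 2 * z) with hS
  set T : ℂ → ℂ := fun z => airyF 1 z + w * (w * airyF 1 (w * z)) + w ^ 2 * (w ^ 2 * airyF 1 (w ^ 2 * z)) with hT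
  have hST : ∀ z, HasDerivAt S (T z) z := fun z =>
    ((airyF_deriv 0 z).add ((airyRot_deriv 0 w z).const_mul w)).add
      ((airyRot_deriv 0 (w ^ 2) z).const_mul (w ^ 2))
  have hW : ∀ z, airyF 0 z * T z = airyF 1 z * S z := by
    intro z
    have h1 := airy_wronsk 1 w (by simp) hw3 z
    have h2 := airy_wronsk 1 (w ^ 2) (by simp) (by linear_combination (w ^ 3 + 1) * hw3) z
    simp only [one_mul] at h1 h2
    simp only [hS, hT]
    linear_combination w * h1 + w ^ 2 * h2 + airyF 0 0 * airyF 1 0 * ((w ^ 2 - w) * hw)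
  have hS0 : S 0 = 0 := by
    simp only [hS, mul_zero]
    linear_combination airyF 0 0 * hw
  have hev : ∀ᶠ z in 𝓝 (0:ℂ), airyF 0 z ≠ 0 :=
    (airyF_diff 0).continuous.continuousAt.eventually_ne airy0
  obtain ⟨r, hr, hb⟩ := Metric.eventually_nhds_iff_ball.1 hev
  have hq : ∀ z ∈ Metric.ball (0:ℂ) r, S z / airyF 0 z = S 0 / airyF 0 0 := by
    intro z hz
    have hd : ∀ z ∈ Metric.ball (0:ℂ) r, HasDerivAt (fun z => S z / airyF 0 z) 0 z := by
      intro z hz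
      refine ((hST z).div (airyF_deriv 0 z) (hb z hz)).congr_deriv ?_
      rw [div_eq_zero_iff]; left
      simp only [zero_add]
      linear_combination hW z
    exact (convex_ball (0:ℂ) r).is_const_of_fderivWithin_eq_zero (𝕜 := ℂ)
      (fun z hz => (hd z hz).differentiableAt.differentiableWithinAt)
      (fun z hz => by
        rw [fderivWithin_of_isOpen Metric.isOpen_ball hz]
        ext; simp [(hd z hz).deriv]) hz (Metric.mem_ball_self hr)
  have hSan : AnalyticOnNhd ℂ S univ := fun z _ =>
    Differentiable.analyticAt (fun z => (hST z).differentiableAt) z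
  have : S = 0 := by
    refine hSan.eq_of_eventuallyEq (g := 0) (fun _ _ => analyticAt_const) (z₀ := 0) ?_
    filter_upwards [Metric.ball_mem_nhds (0:ℂ) hr] with z hz
    have := hq z hz
    rw [hS0, zero_div, div_eq_zero_iff] at this
    exact this.resolve_right (hb z hz)
  exact congrFun this z

lemma poly_exp_lim (R : Polynomial ℂ) :
    Tendsto (fun t : ℝ => R.eval (t : ℂ) * ((Real.exp (-t) : ℝ) : ℂ)) atTop (𝓝 0) := by
  induction R using Polynomial.induction_on' with
  | add p q hp hq =>
    simpa [Polynomial.eval_add, add_mul] using hp.add hq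
  | monomial n a =>
    have h := (continuous_ofReal.tendsto 0).comp (Real.tendsto_pow_mul_exp_neg_atTop_nhds_zero n)
    have h2 := h.const_mul a
    simp only [ofReal_zero, mul_zero] at h2
    refine h2.congr fun t => ?_
    simp only [Polynomial.eval_monomial, Function.comp_apply, ofReal_mul, ofReal_pow]
    ring

lemma airy_sq_poly_lim (R : Polynomial ℂ) :
    Tendsto (fun t : ℝ => R.eval (t : ℂ) * airyF 0 t ^ 2) atTop (𝓝 0) := by
  obtain ⟨C, hC, h0⟩ := airyF_decay 0 0
  have h1 : Tendsto (fun t : ℝ => airyF 0 t) atTop (𝓝 0) := by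
    have h2 := Real.tendsto_exp_neg_atTop_nhds_zero.const_mul C
    rw [mul_zero] at h2
    refine squeeze_zero_norm (fun t => ?_) h2
    simpa using h0 t (by simp)
  have h3 : Tendsto (fun t : ℝ => R.eval (t : ℂ) * airyF 0 t) atTop (𝓝 0) := by
    have h2 := (poly_exp_lim R).norm.const_mul C
    rw [norm_zero, mul_zero] at h2
    refine squeeze_zero_norm (fun t => ?_) h2
    have := h0 t (by simp)
    rw [ofReal_re] at this
    rw [norm_mul, norm_mul, norm_real, Real.norm_eq_abs, abs_of_pos (Real.exp_pos _)]
    calc _ ≤ ‖R.eval (t : ℂ)‖ * (C * Real.exp (-t)) := by gcongr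
      _ = _ := by ring
  have := h3.mul h1
  rw [mul_zero] at this
  exact this.congr fun t => by ring

lemma poly_zero_of_lim (Q : Polynomial ℂ)
    (h : Tendsto (fun t : ℝ => Q.eval (t : ℂ)) atTop (𝓝 0)) : Q = 0 := by
  by_cases hd : 0 < Q.degree
  · exfalso
    have h1 : Tendsto (fun t : ℝ => ‖Q.eval (t : ℂ)‖) atTop atTop := by
      refine Q.tendsto_norm_atTop hd ?_
      simpa using tendsto_abs_atTop_atTop
    exact not_tendsto_nhds_of_tendsto_atTop h1 _ h.norm
  · rw [Polynomial.eq_C_of_degree_le_zero (not_lt.1 hd)] at h ⊢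
    simp only [Polynomial.eval_C] at h
    rw [tendsto_nhds_unique tendsto_const_nhds h]
    simp

lemma airy_not_rational (w : ℂ) (hw : w ^ 2 + w + 1 = 0) (p q : Polynomial ℂ) (hq : q ≠ 0)
    (h : ∀ z, q.eval z * airyF 0 (w * z) = p.eval z * airyF 0 (w ^ 2 * z)) : False := by
  have hw3 : w ^ 3 = 1 := by linear_combination (w - 1) * hw
  have hw0 : w ≠ 0 := by rintro rfl; simp at hw
  set W := airyF 0 0 * airyF 1 0 * (w ^ 2 - w) with hWdef
  have hW : W ≠ 0 := by
    refine mul_ne_zero (mul_ne_zero airy0 airy1) ?_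
    intro h1
    have h2 : w = 1 := by
      have : w * (w - 1) = 0 := by linear_combination h1
      exact sub_eq_zero.1 ((mul_eq_zero.1 this).resolve_left hw0)
    rw [h2] at hw; norm_num at hw
  have hd : ∀ z, q.derivative.eval z * airyF 0 (w * z) + q.eval z * (w * airyF 1 (w * z))
      = p.derivative.eval z * airyF 0 (w ^ 2 * z) + p.eval z * (w ^ 2 * airyF 1 (w ^ 2 * z)) := by
    intro z
    have h1 := (q.hasDerivAt z).mul (airyRot_deriv 0 w z)
    have h2 := (p.hasDerivAt z).mul (airyRot_deriv 0 (w ^ 2) z)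
    have h3 : (fun z => q.eval z * airyF 0 (w * z)) = fun z => p.eval z * airyF 0 (w ^ 2 * z) :=
      funext h
    exact (h1.congr_of_eventuallyEq (Eventually.of_forall fun z => (h z).symm)).unique h2
  have key : ∀ z, q.eval z ^ 2 * W = (q.derivative.eval z * p.eval z
      - q.eval z * p.derivative.eval z) * airyF 0 (w ^ 2 * z) ^ 2 := by
    intro z
    have h1 := airy_wronsk w (w ^ 2) hw3 (by linear_combination (w ^ 3 + 1) * hw3) z
    rw [← hWdef] at h1
    rw [← h1]
    linear_combination (q.eval z * w ^ 2 * airyF 1 (w ^ 2 * z)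
      + q.derivative.eval z * airyF 0 (w ^ 2 * z)) * h z - q.eval z * airyF 0 (w ^ 2 * z) * hd z
  set L : Polynomial ℂ := Polynomial.C w * Polynomial.X with hL
  have hlim := airy_sq_poly_lim
    ((Polynomial.derivative q * p - q * Polynomial.derivative p).comp L)
  have h0 : (q ^ 2 * Polynomial.C W).comp L = 0 := by
    apply poly_zero_of_lim
    refine hlim.congr fun t => ?_
    have h1 := key (w * t)
    have h2 : w ^ 2 * (w * (t : ℂ)) = t := by linear_combination (t : ℂ) * hw3
    rw [h2] at h1
    simp only [Polynomial.eval_comp, hL, Polynomial.eval_mul, Polynomial.eval_sub,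
      Polynomial.eval_C, Polynomial.eval_X, Polynomial.eval_pow]
    exact h1.symm
  apply hq
  apply Polynomial.funext
  intro z
  have h1 := congrArg (Polynomial.eval (w ^ 2 * z)) h0
  have h2 : w * (w ^ 2 * z) = z := by linear_combination z * hw3
  simp only [Polynomial.eval_comp, hL, Polynomial.eval_mul, Polynomial.eval_zero,
      Polynomial.eval_C, Polynomial.eval_X, Polynomial.eval_pow, h2] at h1
  simpa [hW] using h1

lemma exp_pi_third : exp (((Real.pi / 3 : ℝ) : ℂ) * I) ^ 2 - exp (((Real.pi / 3 : ℝ) : ℂ) * I) + 1 = 0 := by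
  rw [exp_mul_I, ← ofReal_cos, ← ofReal_sin, Real.cos_pi_div_three, Real.sin_pi_div_three]
  have h3 : ((Real.sqrt 3 : ℝ) : ℂ) ^ 2 = 3 := by
    rw [← ofReal_pow, Real.sq_sqrt (by norm_num)]; norm_num
  push_cast
  linear_combination (((Real.sqrt 3 : ℝ) : ℂ) ^ 2 / 4) * I_sq - h3 / 4

theorem exists_transcendental_merom_three_equally_spaced_rays :
    ∃ (f : ℂ → ℂ) (P : Set ℂ), MeromOn f P Set.univ ∧ ¬ IsRationalFn f P ∧
      {z : ℂ | z ∉ P ∧ f z = 0} ⊆ Ray (Real.pi / 3) ∧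
      P ⊆ Ray (-(Real.pi / 3)) ∧
      ∀ z : ℂ, z ∉ P → f z = 1 → z.im = 0 ∧ z.re < 0 := by
  set e : ℂ := exp (((Real.pi / 3 : ℝ) : ℂ) * I) with he
  have hee : e ^ 2 - e + 1 = 0 := exp_pi_third
  have he0 : e ≠ 0 := exp_ne_zero _
  have he3 : e ^ 3 = -1 := by linear_combination (e + 1) * hee
  have hw : (e ^ 2) ^ 2 + e ^ 2 + 1 = 0 := by linear_combination (e ^ 2 + e + 1) * hee
  have hU : Differentiable ℂ (fun z => airyF 0 (e ^ 2 * z)) :=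
    fun z => (airyRot_deriv 0 _ z).differentiableAt
  have hV : Differentiable ℂ (fun z => airyF 0 ((e ^ 2) ^ 2 * z)) :=
    fun z => (airyRot_deriv 0 _ z).differentiableAt
  have hUz : ∀ z, airyF 0 (e ^ 2 * z) = 0 → ∃ t : ℝ, 0 < t ∧ z = t * e := by
    intro z hz
    obtain ⟨h1, h2⟩ := airy_zero _ hz
    refine ⟨-(e ^ 2 * z).re, by linarith, ?_⟩
    have h3 : e ^ 2 * z = ((e ^ 2 * z).re : ℂ) := Complex.ext (by simp) (by simpa using h1)
    rw [ofReal_neg, ← h3]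
    linear_combination z * he3
  have hVz : ∀ z, airyF 0 ((e ^ 2) ^ 2 * z) = 0 → ∃ t : ℝ, 0 < t ∧ z * e = t := by
    intro z hz
    obtain ⟨h1, h2⟩ := airy_zero _ hz
    refine ⟨-((e ^ 2) ^ 2 * z).re, by linarith, ?_⟩
    have h3 : (e ^ 2) ^ 2 * z = (((e ^ 2) ^ 2 * z).re : ℂ) :=
      Complex.ext (by simp) (by simpa using h1)
    rw [ofReal_neg, ← h3]
    linear_combination z * e * he3
  have hVne : ∀ z, ∀ᶠ y in 𝓝[≠] z, airyF 0 ((e ^ 2) ^ 2 * y) ≠ 0 := by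
    intro z
    by_contra hcon
    have hfr : ∃ᶠ y in 𝓝[≠] z, airyF 0 ((e ^ 2) ^ 2 * y) = (0 : ℂ → ℂ) y := by
      exact fun hn => hcon hn
    have := AnalyticOnNhd.eq_of_frequently_eq (fun z _ => hV.analyticAt z)
      (g := (0 : ℂ → ℂ)) (fun _ _ => analyticAt_const) hfr
    have := congrFun this 0
    simp [airy0] at this
  have hdisj : ∀ z, airyF 0 ((e ^ 2) ^ 2 * z) = 0 → airyF 0 (e ^ 2 * z) ≠ 0 := by
    intro z hv hu
    have h1 := airy_wronsk (e ^ 2) ((e ^ 2) ^ 2) (by linear_combination (e ^ 3 - 1) * he3)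
      (by linear_combination (e ^ 6 + 1) * (e ^ 3 - 1) * he3) z
    rw [hv, hu] at h1
    have h2 : airyF 0 0 * airyF 1 0 * ((e ^ 2) ^ 2 - e ^ 2) = 0 := by rw [← h1]; ring
    rw [mul_eq_zero, mul_eq_zero] at h2
    have h3 := h2.resolve_left (not_or.2 ⟨airy0, airy1⟩)
    have h4 : e ^ 2 * (e - 2) = 0 := by linear_combination h3 - e ^ 2 * hee
    have h5 : e = 2 := sub_eq_zero.1 ((mul_eq_zero.1 h4).resolve_left (pow_ne_zero 2 he0))
    rw [h5] at hee; norm_num at hee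
  refine ⟨fun z => e * airyF 0 (e ^ 2 * z) / airyF 0 ((e ^ 2) ^ 2 * z),
    {z | airyF 0 ((e ^ 2) ^ 2 * z) = 0}, ⟨subset_univ _, ?_, ?_, ?_⟩, ?_, ?_, ?_, ?_⟩
  · intro z hz
    exact (analyticAt_const.mul (hU.analyticAt z)).div (hV.analyticAt z) hz.2
  · intro z hz
    have h1 : Tendsto (fun y => ‖e * airyF 0 (e ^ 2 * y)‖) (𝓝[≠] z)
        (𝓝 ‖e * airyF 0 (e ^ 2 * z)‖) :=
      ((hU.continuous.const_mul e |>.norm).tendsto z).mono_left nhdsWithin_le_nhds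
    have h2 : Tendsto (fun y => ‖airyF 0 ((e ^ 2) ^ 2 * y)‖) (𝓝[≠] z) (𝓝[>] 0) := by
      refine tendsto_nhdsWithin_iff.2 ⟨?_, ?_⟩
      · have := (hV.continuous.norm.tendsto z).mono_left (nhdsWithin_le_nhds (s := {z}ᶜ))
        have hz' : airyF 0 ((e ^ 2) ^ 2 * z) = 0 := hz
        simpa [hz'] using this
      · filter_upwards [hVne z] with y hy
        exact norm_pos_iff.2 hy
    have h3 := h1.pos_mul_atTop (norm_pos_iff.2 (mul_ne_zero he0 (hdisj z hz)))
      (tendsto_inv_nhdsGT_zero.comp h2)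
    refine h3.congr fun y => ?_
    rw [norm_div]; rfl
  · intro z _ hacc
    rw [accPt_iff_frequently_nhdsNE] at hacc
    exact hacc (hVne z)
  · rintro ⟨p, q, hq, hpq⟩
    refine airy_not_rational (e ^ 2) hw p (Polynomial.C e * q)
      (mul_ne_zero (by simpa using he0) hq) ?_
    have hqne : ∀ᶠ z in 𝓝[≠] (0:ℂ), q.eval z ≠ 0 := by
      have : {z : ℂ | q.eval z = 0}.Finite := by
        refine (q.roots.toFinset.finite_toSet).subset fun z hz => ?_
        simpa [hq] using hz
      have h1 : ({z : ℂ | q.eval z = 0} \ {0})ᶜ ∈ 𝓝 (0:ℂ) :=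
        (this.subset sdiff_subset).isClosed.isOpen_compl.mem_nhds (by simp)
      filter_upwards [nhdsWithin_le_nhds h1, self_mem_nhdsWithin] with z hz hz0 hq0
      exact hz ⟨hq0, hz0⟩
    have hpd := p.differentiable
    have hqd := (Polynomial.C e * q).differentiable
    have := AnalyticOnNhd.eq_of_frequently_eq (𝕜 := ℂ) (z₀ := 0)
      (f := fun z => (Polynomial.C e * q).eval z * airyF 0 (e ^ 2 * z))
      (g := fun z => p.eval z * airyF 0 ((e ^ 2) ^ 2 * z))
      (fun z _ => (hqd.mul hU).analyticAt z) (fun z _ => (hpd.mul hV).analyticAt z) (by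
        apply Eventually.frequently
        filter_upwards [hqne, hVne 0] with z h1 h2
        have h3 := hpq z h2 h1
        rw [div_eq_div_iff h2 h1] at h3
        simp only [Polynomial.eval_mul, Polynomial.eval_C]
        linear_combination h3)
    exact fun z => congrFun this z
  · rintro z ⟨hz, h0⟩
    have h1 := (div_eq_zero_iff.1 h0).resolve_right hz
    exact hUz z ((mul_eq_zero.1 h1).resolve_left he0)
  · intro z hz
    obtain ⟨t, ht, h⟩ := hVz z hz
    refine ⟨t, ht, ?_⟩
    rw [ofReal_neg, neg_mul, exp_neg, ← he, ← h]
    field_simp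
  · intro z hz h1
    rw [div_eq_one_iff_eq hz] at h1
    have h2 := airy_sum (e ^ 2) hw z
    apply airy_zero
    linear_combination h2 - e * h1 - e * airyF 0 ((e ^ 2) ^ 2 * z) * he3
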